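/- Suppose a quantum channel N decomposes as a convex combination N = Σ_i p_i N_i where each N_i is degradable and the p_i are nonnegative reals summing to 1. Then the quantum capacity of N satisfies Q(N) ≤ Σ_i p_i Q^(1)(N_i). -/

import Mathlib

open scoped Matrix Kronecker ComplexOrder

/-- A finite family of Kraus operators from input space `A` to output space `B`. -/
structure KrausFamily (A B : Type) [Fintype A] [DecidableEq A] [Fintype B] [DecidableEq B] :
    Type 1 where
  ι : Type
  [fι : Fintype ι]
  [dι : DecidableEq ι]
  K : ι → Matrix B A ℂ

attribute [instance] KrausFamily.fι KrausFamily.dι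

variable {A B : Type} [Fintype A] [DecidableEq A] [Fintype B] [DecidableEq B]

/-- The trace-preservation condition `Σ Kᵢ† Kᵢ = 1` making a Kraus family a quantum channel. -/
def KrausFamily.IsChannel (N : KrausFamily A B) : Prop :=
  ∑ i, (N.K i)ᴴ * N.K i = 1

/-- The action of a channel: `N(ρ) = Σ Kᵢ ρ Kᵢ†`. -/
noncomputable def KrausFamily.apply (N : KrausFamily A B) (ρ : Matrix A A ℂ) : Matrix B B ℂ :=
  ∑ i, N.K i * ρ * (N.K i)ᴴ

/-- The complementary channel: `N̂(ρ)ᵢⱼ = Tr (Kᵢ ρ Kⱼ†)`. -/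
noncomputable def KrausFamily.compl (N : KrausFamily A B) (ρ : Matrix A A ℂ) :
    Matrix N.ι N.ι ℂ :=
  Matrix.of fun i j => (N.K i * ρ * (N.K j)ᴴ).trace

/-- Von Neumann entropy, base 2: `S(ρ) = −Σ λⱼ log₂ λⱼ` over the eigenvalues of `ρ`
(junk value `0` for non-Hermitian matrices). -/
noncomputable def vnEntropy {n : Type} [Fintype n] [DecidableEq n] (ρ : Matrix n n ℂ) : ℝ :=
  if h : ρ.IsHermitian then -∑ j, h.eigenvalues j * Real.logb 2 (h.eigenvalues j) else 0

/-- A density matrix: positive semidefinite with unit trace. -/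
def IsDensity {n : Type} [Fintype n] (ρ : Matrix n n ℂ) : Prop :=
  ρ.PosSemidef ∧ ρ.trace = 1

/-- Coherent information of `N` at input `φ`: `I^c(N,φ) = S(N(φ)) − S(N̂(φ))`. -/
noncomputable def cohInfo (N : KrausFamily A B) (φ : Matrix A A ℂ) : ℝ :=
  vnEntropy (N.apply φ) - vnEntropy (N.compl φ)

/-- One-shot quantum capacity: `Q^{(1)}(N) = sup_φ I^c(N,φ)` over density matrices `φ`. -/
noncomputable def Q1 (N : KrausFamily A B) : ℝ :=
  sSup {x | ∃ φ : Matrix A A ℂ, IsDensity φ ∧ x = cohInfo N φ}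

/-- The `n`-th tensor power of a Kraus family, whose Kraus operators are all `n`-fold
Kronecker products of Kraus operators of `N`. -/
noncomputable def KrausFamily.pow (N : KrausFamily A B) (n : ℕ) :
    KrausFamily (Fin n → A) (Fin n → B) where
  ι := Fin n → N.ι
  K f := Matrix.of fun b a => ∏ i, N.K (f i) (b i) (a i)

/-- Quantum capacity: `Q(N) = sup_{n ≥ 1} (1/n) Q^{(1)}(N^{⊗n})`. -/
noncomputable def Qcap (N : KrausFamily A B) : ℝ :=
  sSup {x | ∃ n : ℕ, 0 < n ∧ x = (1 / (n : ℝ)) * Q1 (N.pow n)}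

/-- `N` is degradable if some channel `D` maps its output to its complementary output. -/
def KrausFamily.IsDegradable (N : KrausFamily A B) : Prop :=
  ∃ D : KrausFamily B N.ι, D.IsChannel ∧ ∀ ρ : Matrix A A ℂ, D.apply (N.apply ρ) = N.compl ρ

/-- `N` is antidegradable if some channel `D` maps its complementary output to its output. -/
def KrausFamily.IsAntidegradable (N : KrausFamily A B) : Prop :=
  ∃ D : KrausFamily N.ι B, D.IsChannel ∧ ∀ ρ : Matrix A A ℂ, D.apply (N.compl ρ) = N.apply ρ

section Entropy

open Matrix

variable {n k : Type} [Fintype n] [DecidableEq n] [Fintype k] [DecidableEq k]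

/-- `M = V diag(s) Vᴴ` with `V` unitary and `s` real. -/
def Diagonalizes (V : Matrix n n ℂ) (s : n → ℝ) (M : Matrix n n ℂ) : Prop :=
  Vᴴ * V = 1 ∧ M = V * diagonal (fun i => (s i : ℂ)) * Vᴴ

namespace Diagonalizes

variable {V : Matrix n n ℂ} {s : n → ℝ} {M : Matrix n n ℂ}

theorem mul_conjTranspose (h : Diagonalizes V s M) : V * Vᴴ = 1 :=
  mul_eq_one_comm.1 h.1

theorem compress (h : Diagonalizes V s M) : Vᴴ * M * V = diagonal (fun i => (s i : ℂ)) := by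
  rw [h.2]
  calc Vᴴ * (V * diagonal (fun i => (s i : ℂ)) * Vᴴ) * V
      = (Vᴴ * V) * diagonal (fun i => (s i : ℂ)) * (Vᴴ * V) := by simp only [Matrix.mul_assoc]
    _ = _ := by rw [h.1, Matrix.one_mul, Matrix.mul_one]

theorem isHermitian (h : Diagonalizes V s M) : M.IsHermitian := by
  rw [h.2]
  refine isHermitian_mul_mul_conjTranspose V ?_
  refine isHermitian_diagonal_of_self_adjoint _ ?_
  ext i
  simp

theorem charpoly_eq (h : Diagonalizes V s M) :
    M.charpoly = ∏ i, (Polynomial.X - Polynomial.C (s i : ℂ)) := by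
  rw [h.2, charpoly_mul_comm, ← Matrix.mul_assoc, h.1, Matrix.one_mul, charpoly_diagonal]

theorem trace_eq (h : Diagonalizes V s M) : M.trace = ∑ i, (s i : ℂ) := by
  rw [h.2, trace_mul_comm, ← Matrix.mul_assoc, h.1, Matrix.one_mul, trace_diagonal]

end Diagonalizes

theorem Matrix.IsHermitian.diagonalizes {M : Matrix n n ℂ} (h : M.IsHermitian) :
    Diagonalizes (h.eigenvectorUnitary : Matrix n n ℂ) h.eigenvalues M := by
  refine ⟨Unitary.coe_star_mul_self _, ?_⟩
  conv_lhs => rw [h.spectral_theorem, Unitary.conjStarAlgAut_apply]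
  rfl

theorem Matrix.PosSemidef.exists_diagonalizes {M : Matrix n n ℂ} (h : M.PosSemidef) :
    ∃ V s, Diagonalizes V s M ∧ ∀ i, 0 ≤ s i :=
  ⟨_, _, h.1.diagonalizes, h.eigenvalues_nonneg⟩

/-- The entropy is a sum over the roots of the characteristic polynomial. -/
theorem vnEntropy_eq_sum_roots {M : Matrix n n ℂ} (h : M.IsHermitian) :
    vnEntropy M = -(M.charpoly.roots.map fun z : ℂ => z.re * Real.logb 2 z.re).sum := by
  rw [vnEntropy, dif_pos h, h.roots_charpoly_eq_eigenvalues, Multiset.map_map]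
  rfl

theorem Diagonalizes.vnEntropy_eq {V : Matrix n n ℂ} {s : n → ℝ} {M : Matrix n n ℂ}
    (h : Diagonalizes V s M) : vnEntropy M = -∑ i, s i * Real.logb 2 (s i) := by
  rw [vnEntropy_eq_sum_roots h.isHermitian, h.charpoly_eq, Polynomial.roots_prod _ _
    (Finset.prod_ne_zero_iff.2 fun i _ => Polynomial.X_sub_C_ne_zero _)]
  simp [Multiset.bind_singleton]

theorem vnEntropy_transpose {M : Matrix n n ℂ} (h : M.IsHermitian) :
    vnEntropy Mᵀ = vnEntropy M := by
  rw [vnEntropy_eq_sum_roots h, vnEntropy_eq_sum_roots h.transpose, charpoly_transpose]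

/-- `Z Zᴴ` and `Zᴴ Z` have the same nonzero spectrum, hence the same entropy. -/
theorem vnEntropy_mul_conjTranspose_comm (Z : Matrix n k ℂ) :
    vnEntropy (Z * Zᴴ) = vnEntropy (Zᴴ * Z) := by
  rw [vnEntropy_eq_sum_roots (isHermitian_mul_conjTranspose_self Z),
    vnEntropy_eq_sum_roots (isHermitian_conjTranspose_mul_self Z)]
  have h := congrArg (fun q => (q.roots.map fun z : ℂ => z.re * Real.logb 2 z.re).sum)
    (charpoly_mul_comm' Z Zᴴ)
  have h0 (j : ℕ) (m : Type) [Fintype m] [DecidableEq m] (L : Matrix m m ℂ) :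
      ((Polynomial.X ^ j * L.charpoly).roots.map fun z : ℂ => z.re * Real.logb 2 z.re).sum
        = (L.charpoly.roots.map fun z : ℂ => z.re * Real.logb 2 z.re).sum := by
    rw [Polynomial.roots_mul (mul_ne_zero (pow_ne_zero _ Polynomial.X_ne_zero)
      (charpoly_monic L).ne_zero)]
    simp [Multiset.map_nsmul, Multiset.sum_nsmul]
  simp only [h0] at h
  rw [h]

/-- Entropy of a state is nonnegative and at most dimension over `log 2`. -/
theorem IsDensity.vnEntropy_bounds {M : Matrix n n ℂ} (h : IsDensity M) :
    0 ≤ vnEntropy M ∧ vnEntropy M ≤ Fintype.card n / Real.log 2 := by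
  obtain ⟨V, s, hd, hs⟩ := h.1.exists_diagonalizes
  have hlog : 0 < Real.log 2 := Real.log_pos one_lt_two
  have hsum : ∑ i, s i = 1 := by
    have := hd.trace_eq
    rw [h.2] at this
    exact_mod_cast this.symm
  have hle (i : n) : s i ≤ 1 :=
    hsum ▸ Finset.single_le_sum (fun j _ => hs j) (Finset.mem_univ i)
  rw [hd.vnEntropy_eq, ← Finset.sum_neg_distrib]
  constructor
  · refine Finset.sum_nonneg fun i _ => ?_
    rw [Real.logb, ← mul_div_assoc, ← neg_div]
    refine div_nonneg ?_ hlog.le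
    have := Real.negMulLog_nonneg (hs i) (hle i)
    rw [Real.negMulLog] at this
    linarith
  · rw [div_eq_mul_inv, ← nsmul_eq_mul]
    refine Finset.sum_le_card_nsmul _ _ _ fun i _ => ?_
    rw [Real.logb, ← mul_div_assoc, ← neg_div, ← one_div]
    refine div_le_div_of_nonneg_right ?_ hlog.le
    rcases (hs i).eq_or_lt with h0 | h0
    · simp [← h0]
    · have h1 := Real.log_le_sub_one_of_pos (inv_pos.2 h0)
      rw [Real.log_inv] at h1
      have h2 := mul_le_mul_of_nonneg_left h1 h0.le
      rw [mul_sub, mul_inv_cancel₀ h0.ne'] at h2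
      linarith

end Entropy

section Scalar

open Filter Topology Set

variable {α β : Type*} [Fintype α] [Fintype β]

theorem hasDerivAt_sum_mul_log {w r s : α → ℝ} (hr : ∀ a, 0 ≤ r a) (hs : ∀ a, 0 ≤ s a)
    {t : ℝ} (ht : 0 < t) :
    HasDerivAt (fun t => ∑ a, w a * (r a * Real.log (s a + t * r a)))
      (∑ a, w a * (r a ^ 2 / (s a + t * r a))) t := by
  refine HasDerivAt.fun_sum fun a _ => HasDerivAt.const_mul _ ?_
  rcases (hr a).eq_or_lt with h0 | h0
  · simpa [← h0] using hasDerivAt_const t (0 : ℝ)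
  · have hpos : 0 < s a + t * r a := add_pos_of_nonneg_of_pos (hs a) (mul_pos ht h0)
    have h1 : HasDerivAt (fun t => s a + t * r a) (r a) t := by
      simpa using ((hasDerivAt_id t).mul_const (r a)).const_add (s a)
    have h2 := (h1.log hpos.ne').const_mul (r a)
    rwa [← mul_div_assoc, ← sq] at h2

theorem tendsto_sum_mul_log_zero {w r s : α → ℝ} (hsupp : ∀ a, s a = 0 → w a * r a = 0) :
    Tendsto (fun t => ∑ a, w a * (r a * Real.log (s a + t * r a))) (𝓝[>] 0)
      (𝓝 (∑ a, w a * (r a * Real.log (s a)))) := by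
  refine tendsto_finsetSum _ fun a _ => ?_
  simp only [← mul_assoc]
  by_cases h : w a * r a = 0
  · simp [h]
  · have hsa : s a ≠ 0 := fun h' => h (hsupp a h')
    refine Tendsto.const_mul _ (Tendsto.mono_left ?_ nhdsWithin_le_nhds)
    have hc : ContinuousAt (fun t => Real.log (s a + t * r a)) 0 := by
      refine ContinuousAt.log (by fun_prop) (by simpa using hsa)
    simpa [ContinuousAt] using hc

theorem tendsto_sum_mul_log_atTop {w r s : α → ℝ} (hr : ∀ a, 0 ≤ r a) (hs : ∀ a, 0 ≤ s a) :
    Tendsto (fun t => ∑ a, w a * (r a * Real.log (s a + t * r a))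
      - (∑ a, w a * r a) * Real.log t) atTop (𝓝 (∑ a, w a * (r a * Real.log (r a)))) := by
  have h : ∀ a, Tendsto (fun t => w a * (r a * Real.log (s a + t * r a)) - w a * r a * Real.log t)
      atTop (𝓝 (w a * (r a * Real.log (r a)))) := by
    intro a
    rcases (hr a).eq_or_lt with h0 | h0
    · simp [← h0]
    · have h1 : Tendsto (fun t : ℝ => Real.log (s a / t + r a)) atTop (𝓝 (Real.log (r a))) := by
        have : Tendsto (fun t : ℝ => s a / t + r a) atTop (𝓝 (0 + r a)) :=
          (tendsto_const_nhds.div_atTop tendsto_id).add_const _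
        rw [zero_add] at this
        exact this.log h0.ne'
      have h2 := (h1.const_mul (r a)).const_mul (w a)
      refine h2.congr' ?_
      filter_upwards [eventually_gt_atTop 0] with t ht
      have : s a + t * r a = t * (s a / t + r a) := by field_simp
      have hpos : 0 < s a / t + r a := add_pos_of_nonneg_of_pos (div_nonneg (hs a) ht.le) h0
      rw [this, Real.log_mul ht.ne' hpos.ne']
      ring
  have := tendsto_finsetSum Finset.univ fun a _ => h a
  refine this.congr fun t => ?_
  rw [Finset.sum_sub_distrib, Finset.sum_mul]

/-- Comparison of the resolvent functionals `∑ w r² / (s + t r)` for all `t > 0` integrates to a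
comparison of relative entropies. -/
theorem sum_mul_log_sub_log_le {w r s : α → ℝ} {w' r' s' : β → ℝ}
    (hr : ∀ a, 0 ≤ r a) (hs : ∀ a, 0 ≤ s a) (hr' : ∀ b, 0 ≤ r' b) (hs' : ∀ b, 0 ≤ s' b)
    (hsupp : ∀ a, s a = 0 → w a * r a = 0) (hsupp' : ∀ b, s' b = 0 → w' b * r' b = 0)
    (hmass : ∑ b, w' b * r' b = ∑ a, w a * r a)
    (hres : ∀ t, 0 < t → ∑ b, w' b * (r' b ^ 2 / (s' b + t * r' b))
      ≤ ∑ a, w a * (r a ^ 2 / (s a + t * r a))) :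
    ∑ b, w' b * (r' b * Real.log (r' b)) - ∑ b, w' b * (r' b * Real.log (s' b))
      ≤ ∑ a, w a * (r a * Real.log (r a)) - ∑ a, w a * (r a * Real.log (s a)) := by
  set H : ℝ → ℝ := fun t => ∑ a, w a * (r a * Real.log (s a + t * r a))
    - ∑ b, w' b * (r' b * Real.log (s' b + t * r' b)) with hH
  have hder (t : ℝ) (ht : 0 < t) := (hasDerivAt_sum_mul_log (w := w) hr hs ht).sub
    (hasDerivAt_sum_mul_log (w := w') hr' hs' ht)
  have hmono : MonotoneOn H (Ioi 0) := by
    refine monotoneOn_of_deriv_nonneg (convex_Ioi 0)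
      (fun t ht => (hder t ht).continuousAt.continuousWithinAt)
      (fun t ht => ?_) (fun t ht => ?_) <;> rw [interior_Ioi] at ht
    · exact (hder t ht).differentiableAt.differentiableWithinAt
    · rw [show deriv H t = _ from (hder t ht).deriv]
      exact sub_nonneg.2 (hres t ht)
  have h0 : Tendsto H (𝓝[>] 0) _ :=
    (tendsto_sum_mul_log_zero hsupp).sub (tendsto_sum_mul_log_zero hsupp')
  have hinf : Tendsto H atTop _ :=
    ((tendsto_sum_mul_log_atTop (w := w) hr hs).sub
      (tendsto_sum_mul_log_atTop (w := w') hr' hs')).congr fun t => by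
        rw [hmass, sub_sub_sub_cancel_right]
  have hle (t : ℝ) (ht : 0 < t) := le_of_tendsto h0 (b := H t) (by
    filter_upwards [Ioo_mem_nhdsGT ht] with u hu
    exact hmono hu.1 ht hu.2.le)
  have := ge_of_tendsto hinf (by
    filter_upwards [eventually_gt_atTop 0] with t ht using hle t ht)
  linarith

end Scalar

section RelativeEntropy

open Matrix

variable {n n' : Type} [Fintype n] [DecidableEq n] [Fintype n'] [DecidableEq n']

/-- A quadratic form in `X` whose supremum is `⟨ρ^{1/2}, (Δ + t)⁻¹ ρ^{1/2}⟩`, with `Δ` the relative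
modular operator
of `σ` and `ρ`. It is linear in `(ρ, σ)`. -/
noncomputable def resolventForm (t : ℝ) (X ρ σ : Matrix n n ℂ) : ℝ :=
  2 * (ρ * X).trace.re - (σ * (X * Xᴴ)).trace.re - t * (ρ * (Xᴴ * X)).trace.re

/-- `Re Tr (ρ log₂ σ)` computed in an eigenbasis of `σ`. -/
noncomputable def crossLog (V : Matrix n n ℂ) (s : n → ℝ) (ρ : Matrix n n ℂ) : ℝ :=
  ∑ j, ((Vᴴ * ρ * V) j j).re * Real.logb 2 (s j)

theorem trace_diagonal_mul (d : n → ℂ) (M : Matrix n n ℂ) :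
    (diagonal d * M).trace = ∑ i, d i * M i i := by
  simp [trace, diagonal_mul]

theorem trace_diagonalized_mul (U Y : Matrix n n ℂ) (d : n → ℂ) :
    (U * diagonal d * Uᴴ * Y).trace = ∑ i, d i * (Uᴴ * Y * U) i i := by
  rw [Matrix.mul_assoc, Matrix.mul_assoc, trace_mul_comm, Matrix.mul_assoc, trace_diagonal_mul]

section

variable {U V ρ σ : Matrix n n ℂ} {r s : n → ℝ}

/-- The squared overlap of two eigenvectors. -/
noncomputable def overlap (U V : Matrix n n ℂ) (x : n × n) : ℝ :=
  Complex.normSq ((Vᴴ * U) x.2 x.1)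

theorem overlap_nonneg {m : Type} [Fintype m] (U V : Matrix m m ℂ) (x : m × m) :
    0 ≤ overlap U V x :=
  Complex.normSq_nonneg _

theorem sum_overlap (hU : Diagonalizes U r ρ) (hV : Diagonalizes V s σ) (i : n) :
    ∑ j, overlap U V (i, j) = 1 := by
  have h : (Vᴴ * U)ᴴ * (Vᴴ * U) = 1 := by
    rw [conjTranspose_mul, conjTranspose_conjTranspose]
    calc Uᴴ * V * (Vᴴ * U) = Uᴴ * (V * Vᴴ) * U := by simp only [Matrix.mul_assoc]
      _ = 1 := by rw [hV.mul_conjTranspose, Matrix.mul_one, hU.1]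
  have h2 := congrFun (congrFun h i) i
  rw [mul_apply, one_apply_eq] at h2
  have h3 := congrArg Complex.re h2
  simpa [conjTranspose_apply, overlap, Complex.normSq_apply] using h3

theorem sum_overlap_mul (hU : Diagonalizes U r ρ) (j : n) :
    ∑ i, overlap U V (i, j) * r i = ((Vᴴ * ρ * V) j j).re := by
  have h : Vᴴ * ρ * V = (Vᴴ * U) * diagonal (fun i => (r i : ℂ)) * (Vᴴ * U)ᴴ := by
    rw [hU.2, conjTranspose_mul, conjTranspose_conjTranspose]
    simp only [Matrix.mul_assoc]
  rw [h, mul_apply, Complex.re_sum]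
  refine Finset.sum_congr rfl fun i _ => ?_
  simp only [mul_diagonal, conjTranspose_apply, overlap, Complex.normSq_apply]
  simp
  ring

theorem resolventForm_eq (hU : Diagonalizes U r ρ) (hV : Diagonalizes V s σ) (t : ℝ)
    (x : Matrix n n ℂ) :
    resolventForm t (V * x * Uᴴ) ρ σ = ∑ y : n × n,
      (2 * r y.1 * (star ((Vᴴ * U) y.2 y.1) * x y.2 y.1).re
        - (s y.2 + t * r y.1) * Complex.normSq (x y.2 y.1)) := by
  have e1 : Uᴴ * (V * x * Uᴴ) * U = (Vᴴ * U)ᴴ * x := by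
    rw [conjTranspose_mul, conjTranspose_conjTranspose]
    calc Uᴴ * (V * x * Uᴴ) * U = Uᴴ * V * x * (Uᴴ * U) := by simp only [Matrix.mul_assoc]
      _ = _ := by rw [hU.1, Matrix.mul_one]
  have e2 : Vᴴ * (V * x * Uᴴ * (V * x * Uᴴ)ᴴ) * V = x * xᴴ := by
    simp only [conjTranspose_mul, conjTranspose_conjTranspose]
    calc Vᴴ * (V * x * Uᴴ * (U * (xᴴ * Vᴴ))) * V
        = (Vᴴ * V) * x * (Uᴴ * U) * xᴴ * (Vᴴ * V) := by simp only [Matrix.mul_assoc]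
      _ = _ := by rw [hU.1, hV.1]; simp
  have e3 : Uᴴ * ((V * x * Uᴴ)ᴴ * (V * x * Uᴴ)) * U = xᴴ * x := by
    simp only [conjTranspose_mul, conjTranspose_conjTranspose]
    calc Uᴴ * (U * (xᴴ * Vᴴ) * (V * x * Uᴴ)) * U
        = (Uᴴ * U) * xᴴ * (Vᴴ * V) * x * (Uᴴ * U) := by simp only [Matrix.mul_assoc]
      _ = _ := by rw [hU.1, hV.1]; simp
  have f1 : (ρ * (V * x * Uᴴ)).trace.re
      = ∑ y : n × n, r y.1 * (star ((Vᴴ * U) y.2 y.1) * x y.2 y.1).re := by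
    rw [hU.2, trace_diagonalized_mul, e1, Fintype.sum_prod_type, Complex.re_sum]
    refine Finset.sum_congr rfl fun i _ => ?_
    rw [Complex.re_ofReal_mul, mul_apply, Complex.re_sum, Finset.mul_sum]
    rfl
  have f2 : (σ * (V * x * Uᴴ * (V * x * Uᴴ)ᴴ)).trace.re
      = ∑ y : n × n, s y.2 * Complex.normSq (x y.2 y.1) := by
    rw [hV.2, trace_diagonalized_mul, e2, Fintype.sum_prod_type_right, Complex.re_sum]
    refine Finset.sum_congr rfl fun i _ => ?_
    rw [Complex.re_ofReal_mul, mul_apply, Complex.re_sum, Finset.mul_sum]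
    simp [conjTranspose_apply, Complex.normSq_apply]
  have f3 : (ρ * ((V * x * Uᴴ)ᴴ * (V * x * Uᴴ))).trace.re
      = ∑ y : n × n, r y.1 * Complex.normSq (x y.2 y.1) := by
    rw [hU.2, trace_diagonalized_mul, e3, Fintype.sum_prod_type, Complex.re_sum]
    refine Finset.sum_congr rfl fun i _ => ?_
    rw [Complex.re_ofReal_mul, mul_apply, Complex.re_sum, Finset.mul_sum]
    simp [conjTranspose_apply, Complex.normSq_apply]
  rw [resolventForm, f1, f2, f3, Finset.mul_sum, Finset.mul_sum, ← Finset.sum_sub_distrib,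
    ← Finset.sum_sub_distrib]
  refine Finset.sum_congr rfl fun y _ => ?_
  ring

theorem resolventForm_le (hU : Diagonalizes U r ρ) (hV : Diagonalizes V s σ)
    (hr : ∀ i, 0 ≤ r i) (hs : ∀ j, 0 ≤ s j) {t : ℝ} (ht : 0 < t) (X : Matrix n n ℂ) :
    resolventForm t X ρ σ
      ≤ ∑ y : n × n, overlap U V y * (r y.1 ^ 2 / (s y.2 + t * r y.1)) := by
  have hX : X = V * (Vᴴ * X * U) * Uᴴ := by
    calc X = (V * Vᴴ) * X * (U * Uᴴ) := by
          rw [hV.mul_conjTranspose, hU.mul_conjTranspose, Matrix.one_mul, Matrix.mul_one]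
      _ = _ := by simp only [Matrix.mul_assoc]
  rw [hX, resolventForm_eq hU hV]
  refine Finset.sum_le_sum fun y _ => ?_
  generalize (Vᴴ * X * U) y.2 y.1 = x
  rw [overlap]
  generalize (Vᴴ * U) y.2 y.1 = g
  have hc : 0 ≤ s y.2 + t * r y.1 := add_nonneg (hs _) (mul_nonneg ht.le (hr _))
  rcases hc.eq_or_lt with h0 | h0
  · have : r y.1 = 0 := by
      have h1 := mul_nonneg ht.le (hr y.1)
      have h2 : t * r y.1 = 0 := le_antisymm (by linarith [hs y.2]) h1
      exact (mul_eq_zero.1 h2).resolve_left ht.ne'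
    rw [← h0, this]
    simp
  · rw [← mul_div_assoc, le_div_iff₀ h0]
    simp only [Complex.normSq_apply, Complex.star_def, Complex.mul_re, Complex.conj_re,
      Complex.conj_im]
    nlinarith [sq_nonneg (r y.1 * g.re - (s y.2 + t * r y.1) * x.re),
      sq_nonneg (r y.1 * g.im - (s y.2 + t * r y.1) * x.im)]

theorem exists_resolventForm_eq (hU : Diagonalizes U r ρ) (hV : Diagonalizes V s σ)
    (t : ℝ) :
    ∃ X, resolventForm t X ρ σ
      = ∑ y : n × n, overlap U V y * (r y.1 ^ 2 / (s y.2 + t * r y.1)) := by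
  refine ⟨V * (Matrix.of fun j i => (Vᴴ * U) j i * ((r i / (s j + t * r i) : ℝ) : ℂ)) * Uᴴ, ?_⟩
  rw [resolventForm_eq hU hV]
  refine Finset.sum_congr rfl fun y _ => ?_
  simp only [of_apply]
  rw [overlap]
  generalize (Vᴴ * U) y.2 y.1 = g
  rw [Complex.normSq_mul, Complex.normSq_ofReal, ← mul_assoc, Complex.star_def,
    mul_comm (starRingEnd ℂ g), Complex.mul_conj, ← Complex.ofReal_mul, Complex.ofReal_re]
  by_cases h : s y.2 + t * r y.1 = 0
  · simp [h]
  · field_simp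
    ring

end

/-- If every value of the resolvent form on the left is dominated by a weighted sum of values on the
right, then so is the relative entropy `Tr ρ log ρ - Tr ρ log σ`. -/
theorem relEntropy_le_of_resolventForm_le {κ : Type} [Fintype κ] {p : κ → ℝ} (hp : ∀ k, 0 ≤ p k)
    {ρ σ V : κ → Matrix n n ℂ} {s : κ → n → ℝ} {ρ' σ' V' : Matrix n' n' ℂ} {s' : n' → ℝ}
    (hρ : ∀ k, (ρ k).PosSemidef) (hρ' : ρ'.PosSemidef)
    (hV : ∀ k, Diagonalizes (V k) (s k) (σ k)) (hV' : Diagonalizes V' s' σ')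
    (hs : ∀ k j, 0 ≤ s k j) (hs' : ∀ j, 0 ≤ s' j)
    (hsupp : ∀ k j, s k j = 0 → (((V k)ᴴ * ρ k * V k) j j).re = 0)
    (hsupp' : ∀ j, s' j = 0 → ((V'ᴴ * ρ' * V') j j).re = 0)
    (htr : ρ'.trace.re = ∑ k, p k * (ρ k).trace.re)
    (hform : ∀ X', ∃ X : κ → Matrix n n ℂ, ∀ t, 0 < t →
      resolventForm t X' ρ' σ' ≤ ∑ k, p k * resolventForm t (X k) (ρ k) (σ k)) :
    -vnEntropy ρ' - crossLog V' s' ρ'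
      ≤ ∑ k, p k * (-vnEntropy (ρ k) - crossLog (V k) (s k) (ρ k)) := by
  choose U r hU hr using fun k => (hρ k).exists_diagonalizes
  obtain ⟨U', r', hU', hr'⟩ := hρ'.exists_diagonalizes
  have hlog : 0 < Real.log 2 := Real.log_pos one_lt_two
  have mass {m : Type} [Fintype m] [DecidableEq m] {U V ρ σ : Matrix m m ℂ} {r s : m → ℝ}
      (hU : Diagonalizes U r ρ) (hV : Diagonalizes V s σ) (f : m → ℝ) :
      ∑ y : m × m, overlap U V y * f y.1 = ∑ i, f i := by
    rw [Fintype.sum_prod_type]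
    refine Finset.sum_congr rfl fun i _ => ?_
    simp only
    rw [← Finset.sum_mul, sum_overlap hU hV, one_mul]
  have cross {m : Type} [Fintype m] [DecidableEq m] {U V ρ : Matrix m m ℂ} {r : m → ℝ}
      (hU : Diagonalizes U r ρ) (f : m → ℝ) :
      ∑ y : m × m, overlap U V y * (r y.1 * f y.2) = ∑ j, ((Vᴴ * ρ * V) j j).re * f j := by
    rw [Fintype.sum_prod_type_right]
    refine Finset.sum_congr rfl fun j _ => ?_
    rw [← sum_overlap_mul hU, Finset.sum_mul]
    refine Finset.sum_congr rfl fun i _ => ?_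
    ring
  have supp {m : Type} [Fintype m] [DecidableEq m] {U V ρ : Matrix m m ℂ} {r s : m → ℝ}
      (hU : Diagonalizes U r ρ) (hr : ∀ i, 0 ≤ r i)
      (h : ∀ j, s j = 0 → ((Vᴴ * ρ * V) j j).re = 0) (y : m × m) (hy : s y.2 = 0) :
      overlap U V y * r y.1 = 0 := by
    have h1 := h _ hy
    rw [← sum_overlap_mul hU, Finset.sum_eq_zero_iff_of_nonneg fun i _ =>
      mul_nonneg (overlap_nonneg _ _ _) (hr i)] at h1
    exact h1 y.1 (Finset.mem_univ _)
  have tr {m : Type} [Fintype m] [DecidableEq m] {U ρ : Matrix m m ℂ} {r : m → ℝ}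
      (hU : Diagonalizes U r ρ) : ρ.trace.re = ∑ i, r i := by
    rw [hU.trace_eq, ← Complex.ofReal_sum, Complex.ofReal_re]
  have key := sum_mul_log_sub_log_le (α := κ × n × n) (β := n' × n')
    (w := fun a => p a.1 * overlap (U a.1) (V a.1) a.2) (r := fun a => r a.1 a.2.1)
    (s := fun a => s a.1 a.2.2) (w' := overlap U' V') (r' := fun b => r' b.1)
    (s' := fun b => s' b.2) (fun a => hr _ _) (fun a => hs _ _) (fun b => hr' _) (fun b => hs' _)
    (fun a ha => by rw [mul_assoc, supp (hU a.1) (hr a.1) (hsupp a.1) a.2 ha, mul_zero])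
    (fun b hb => supp hU' hr' hsupp' b hb)
    (by
      rw [mass hU' hV' r', ← tr hU', htr, Fintype.sum_prod_type]
      refine Finset.sum_congr rfl fun k _ => ?_
      simp only [mul_assoc]
      rw [← Finset.mul_sum, mass (hU k) (hV k) (r k), tr (hU k)])
    (fun t ht => by
      obtain ⟨X', hX'⟩ := exists_resolventForm_eq hU' hV' t
      obtain ⟨X, hX⟩ := hform X'
      rw [← hX', Fintype.sum_prod_type]
      refine (hX t ht).trans (Finset.sum_le_sum fun k _ => ?_)
      simp only [mul_assoc]
      rw [← Finset.mul_sum]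
      exact mul_le_mul_of_nonneg_left
        (resolventForm_le (hU k) (hV k) (hr k) (hs k) ht (X k)) (hp k))
  rw [mass hU' hV' fun i => r' i * Real.log (r' i), cross hU' fun j => Real.log (s' j),
    Fintype.sum_prod_type, Fintype.sum_prod_type] at key
  have ent {m : Type} [Fintype m] [DecidableEq m] {U V ρ : Matrix m m ℂ} {r s : m → ℝ}
      (hU : Diagonalizes U r ρ) : -vnEntropy ρ - crossLog V s ρ
        = (∑ i, r i * Real.log (r i) - ∑ j, ((Vᴴ * ρ * V) j j).re * Real.log (s j))
          / Real.log 2 := by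
    rw [hU.vnEntropy_eq, crossLog, neg_neg, sub_div, Finset.sum_div, Finset.sum_div]
    simp only [Real.logb, mul_div_assoc]
  rw [ent hU']
  simp only [fun k => ent (V := V k) (s := s k) (hU k)]
  simp only [← mul_div_assoc, ← Finset.sum_div]
  refine div_le_div_of_nonneg_right (key.trans (le_of_eq ?_)) hlog.le
  rw [← Finset.sum_sub_distrib]
  refine Finset.sum_congr rfl fun k _ => ?_
  simp only [mul_assoc]
  rw [← Finset.mul_sum, ← Finset.mul_sum, ← mul_sub, mass (hU k) (hV k) fun i =>
      r k i * Real.log (r k i),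
    cross (hU k) fun j => Real.log (s k j)]
  simp only [Matrix.mul_assoc]

end RelativeEntropy

section Kraus

open Matrix

namespace KrausFamily

variable {A B : Type} [Fintype A] [DecidableEq A] [Fintype B] [DecidableEq B]

/-- The action of a Kraus family as a linear map. -/
noncomputable def applyLin (N : KrausFamily A B) : Matrix A A ℂ →ₗ[ℂ] Matrix B B ℂ where
  toFun := N.apply
  map_add' X Y := by
    simp only [apply, Matrix.mul_add, Matrix.add_mul, Finset.sum_add_distrib]
  map_smul' c X := by
    simp only [apply, Matrix.mul_smul, Matrix.smul_mul, Finset.smul_sum, RingHom.id_apply]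

theorem applyLin_apply (N : KrausFamily A B) (X : Matrix A A ℂ) : N.applyLin X = N.apply X := rfl

theorem apply_posSemidef (N : KrausFamily A B) {ρ : Matrix A A ℂ} (h : ρ.PosSemidef) :
    (N.apply ρ).PosSemidef :=
  posSemidef_sum _ fun i _ => h.mul_mul_conjTranspose_same (N.K i)

/-- The Heisenberg-picture dual of a Kraus family. -/
noncomputable def dual (N : KrausFamily A B) (X : Matrix B B ℂ) : Matrix A A ℂ :=
  ∑ i, (N.K i)ᴴ * X * N.K i

theorem trace_apply_mul (N : KrausFamily A B) (ρ : Matrix A A ℂ) (X : Matrix B B ℂ) :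
    (N.apply ρ * X).trace = (ρ * N.dual X).trace := by
  simp only [apply, dual, Finset.sum_mul, Finset.mul_sum, trace_sum]
  refine Finset.sum_congr rfl fun i _ => ?_
  rw [Matrix.mul_assoc, Matrix.mul_assoc, trace_mul_comm]
  simp only [Matrix.mul_assoc]

theorem IsChannel.trace_apply {N : KrausFamily A B} (hN : N.IsChannel) (ρ : Matrix A A ℂ) :
    (N.apply ρ).trace = ρ.trace := by
  have h := N.trace_apply_mul ρ 1
  rw [Matrix.mul_one, dual] at h
  simp only [Matrix.mul_one] at h
  rw [h, show ∑ i, (N.K i)ᴴ * N.K i = 1 from hN, Matrix.mul_one]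

theorem IsChannel.isDensity_apply {N : KrausFamily A B} (hN : N.IsChannel) {ρ : Matrix A A ℂ}
    (h : IsDensity ρ) : IsDensity (N.apply ρ) :=
  ⟨N.apply_posSemidef h.1, (hN.trace_apply ρ).trans h.2⟩

theorem dual_conjTranspose (N : KrausFamily A B) (X : Matrix B B ℂ) :
    N.dual Xᴴ = (N.dual X)ᴴ := by
  simp only [dual, conjTranspose_sum, conjTranspose_mul, conjTranspose_conjTranspose,
    Matrix.mul_assoc]

/-- The Kadison-Schwarz inequality, tested against a positive semidefinite matrix. -/
theorem IsChannel.schwarz {N : KrausFamily A B} (hN : N.IsChannel) {σ : Matrix A A ℂ}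
    (hσ : σ.PosSemidef) (X : Matrix B B ℂ) :
    (σ * (N.dual X * (N.dual X)ᴴ)).trace.re ≤ (N.apply σ * (X * Xᴴ)).trace.re := by
  set Y := N.dual X with hY
  have hG : N.dual (X * Xᴴ) - Y * Yᴴ
      = ∑ i, (Xᴴ * N.K i - N.K i * Yᴴ)ᴴ * (Xᴴ * N.K i - N.K i * Yᴴ) := by
    have e (i : N.ι) : (Xᴴ * N.K i - N.K i * Yᴴ)ᴴ * (Xᴴ * N.K i - N.K i * Yᴴ)
        = (N.K i)ᴴ * (X * Xᴴ) * N.K i - ((N.K i)ᴴ * X * N.K i) * Yᴴ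
          - Y * ((N.K i)ᴴ * Xᴴ * N.K i) + Y * ((N.K i)ᴴ * N.K i) * Yᴴ := by
      simp only [conjTranspose_sub, conjTranspose_mul, conjTranspose_conjTranspose,
        Matrix.sub_mul, Matrix.mul_sub, Matrix.mul_assoc]
      abel
    simp only [e]
    rw [Finset.sum_add_distrib, Finset.sum_sub_distrib, Finset.sum_sub_distrib, ← Finset.sum_mul,
      ← Finset.mul_sum, ← Finset.sum_mul, ← Finset.mul_sum,
      show ∑ i, (N.K i)ᴴ * N.K i = 1 from hN, Matrix.mul_one,
      show ∑ i, (N.K i)ᴴ * X * N.K i = Y from rfl,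
      show ∑ i, (N.K i)ᴴ * Xᴴ * N.K i = Yᴴ from N.dual_conjTranspose X]
    simp only [dual]
    abel
  rw [trace_apply_mul, ← sub_nonneg, ← Complex.sub_re, ← trace_sub, ← Matrix.mul_sub, hG,
    Finset.mul_sum, trace_sum, Complex.re_sum]
  refine Finset.sum_nonneg fun i _ => ?_
  rw [← Matrix.mul_assoc, trace_mul_comm, ← Matrix.mul_assoc]
  exact (Complex.nonneg_iff.1 (hσ.mul_mul_conjTranspose_same _).trace_nonneg).1

theorem IsChannel.resolventForm_apply_le {N : KrausFamily A B} (hN : N.IsChannel)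
    {ρ σ : Matrix A A ℂ} (hρ : ρ.PosSemidef) (hσ : σ.PosSemidef) {t : ℝ} (ht : 0 ≤ t)
    (X : Matrix B B ℂ) :
    resolventForm t X (N.apply ρ) (N.apply σ) ≤ resolventForm t (N.dual X) ρ σ := by
  have h1 := hN.schwarz hσ X
  have h2 := mul_le_mul_of_nonneg_left (hN.schwarz hρ Xᴴ) ht
  rw [dual_conjTranspose, conjTranspose_conjTranspose, conjTranspose_conjTranspose] at h2
  rw [resolventForm, resolventForm, trace_apply_mul N ρ X]
  linarith

/-- Data processing inequality for the quantum relative entropy. -/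
theorem IsChannel.relEntropy_apply_le {N : KrausFamily A B} (hN : N.IsChannel)
    {ρ σ V : Matrix A A ℂ} {s : A → ℝ} {V' : Matrix B B ℂ} {s' : B → ℝ}
    (hρ : ρ.PosSemidef) (hσ : σ.PosSemidef)
    (hV : Diagonalizes V s σ) (hV' : Diagonalizes V' s' (N.apply σ))
    (hs : ∀ j, 0 ≤ s j) (hs' : ∀ j, 0 ≤ s' j)
    (hsupp : ∀ j, s j = 0 → ((Vᴴ * ρ * V) j j).re = 0)
    (hsupp' : ∀ j, s' j = 0 → ((V'ᴴ * N.apply ρ * V') j j).re = 0) :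
    -vnEntropy (N.apply ρ) - crossLog V' s' (N.apply ρ) ≤ -vnEntropy ρ - crossLog V s ρ := by
  have := relEntropy_le_of_resolventForm_le (κ := Unit) (p := fun _ => 1) (fun _ => zero_le_one)
    (ρ := fun _ => ρ) (fun _ => hρ) (N.apply_posSemidef hρ) (fun _ => hV) hV' (fun _ => hs) hs'
    (fun _ => hsupp) hsupp' (by simp [hN.trace_apply])
    (fun X' => ⟨fun _ => N.dual X', fun t ht => by
      simpa using hN.resolventForm_apply_le hρ hσ ht.le X'⟩)
  simpa using this

/-- The complementary channel as a Kraus family. -/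
def complFamily (N : KrausFamily A B) : KrausFamily A N.ι where
  ι := B
  K b := Matrix.of fun i a => N.K i b a

theorem complFamily_apply (N : KrausFamily A B) (ρ : Matrix A A ℂ) :
    N.complFamily.apply ρ = N.compl ρ := by
  ext i j
  simp only [apply, compl, complFamily, trace, of_apply, diag_apply, Matrix.sum_apply]
  rfl

theorem IsChannel.complFamily {N : KrausFamily A B} (hN : N.IsChannel) :
    N.complFamily.IsChannel := by
  unfold IsChannel at *
  rw [← hN]
  ext a a'
  simp only [KrausFamily.complFamily, Matrix.sum_apply, mul_apply, conjTranspose_apply, of_apply]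
  exact Finset.sum_comm

theorem bddAbove_cohInfo {N : KrausFamily A B} (hN : N.IsChannel) :
    BddAbove {x | ∃ φ : Matrix A A ℂ, IsDensity φ ∧ x = cohInfo N φ} := by
  refine ⟨Fintype.card B / Real.log 2, ?_⟩
  rintro _ ⟨φ, hφ, rfl⟩
  have h1 := (hN.isDensity_apply hφ).vnEntropy_bounds.2
  have h2 := (hN.complFamily.isDensity_apply hφ).vnEntropy_bounds.1
  rw [complFamily_apply] at h2
  rw [cohInfo]
  linarith

theorem cohInfo_le_Q1 {N : KrausFamily A B} (hN : N.IsChannel) {φ : Matrix A A ℂ}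
    (hφ : IsDensity φ) : cohInfo N φ ≤ Q1 N :=
  le_csSup (bddAbove_cohInfo hN) ⟨φ, hφ, rfl⟩

end KrausFamily

end Kraus

section Tensor

open Matrix

variable {I : Type}

section PiMat

variable [Fintype I] {A B C : I → Type}

/-- The tensor product of a finite family of matrices. -/
def piMat (X : ∀ i, Matrix (A i) (B i) ℂ) : Matrix (∀ i, A i) (∀ i, B i) ℂ :=
  Matrix.of fun a b => ∏ i, X i (a i) (b i)

theorem piMat_apply (X : ∀ i, Matrix (A i) (B i) ℂ) (a : ∀ i, A i) (b : ∀ i, B i) :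
    piMat X a b = ∏ i, X i (a i) (b i) := rfl

theorem piMat_conjTranspose (X : ∀ i, Matrix (A i) (B i) ℂ) :
    (piMat X)ᴴ = piMat fun i => (X i)ᴴ := by
  ext b a
  simp [conjTranspose_apply, piMat_apply]

theorem piMat_smul (c : I → ℂ) (X : ∀ i, Matrix (A i) (B i) ℂ) :
    (piMat fun i => c i • X i) = (∏ i, c i) • piMat X := by
  ext a b
  simp [piMat_apply, Finset.prod_mul_distrib]

theorem piMat_single [∀ i, DecidableEq (A i)] [∀ i, DecidableEq (B i)] (a : ∀ i, A i)
    (b : ∀ i, B i) : (piMat fun i => single (a i) (b i) (1 : ℂ)) = single a b 1 := by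
  ext a' b'
  simp only [piMat_apply, single_apply, Finset.prod_ite_zero, Finset.mem_univ, true_imp_iff,
    Finset.prod_const_one, funext_iff, forall_and]

theorem piMat_diagonal [∀ i, DecidableEq (A i)] (d : ∀ i, A i → ℂ) :
    (piMat fun i => diagonal (d i)) = diagonal fun a => ∏ i, d i (a i) := by
  ext a b
  rw [piMat_apply]
  by_cases h : a = b
  · subst h
    simp
  · obtain ⟨i, hi⟩ := Function.ne_iff.1 h
    rw [diagonal_apply_ne _ h]
    exact Finset.prod_eq_zero (Finset.mem_univ i) (diagonal_apply_ne _ hi)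

theorem piMat_one [∀ i, DecidableEq (A i)] :
    (piMat fun i => (1 : Matrix (A i) (A i) ℂ)) = 1 := by
  simpa using piMat_diagonal (fun i (_ : A i) => (1 : ℂ))

/-- Linear maps on a tensor product of matrix spaces agree if they agree on pure tensors. -/
theorem linearMap_ext_piMat [∀ i, Fintype (A i)] [∀ i, Fintype (B i)] [∀ i, DecidableEq (A i)]
    [∀ i, DecidableEq (B i)] {W : Type*} [AddCommMonoid W] [Module ℂ W]
    {f g : Matrix (∀ i, A i) (∀ i, B i) ℂ →ₗ[ℂ] W} (h : ∀ X, f (piMat X) = g (piMat X)) :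
    f = g := by
  refine Matrix.ext_linearMap _ fun a b => LinearMap.ext_ring ?_
  simpa [piMat_single] using h fun i => single (a i) (b i) 1

variable [DecidableEq I]

theorem piMat_mul [∀ i, Fintype (B i)] (X : ∀ i, Matrix (A i) (B i) ℂ)
    (Y : ∀ i, Matrix (B i) (C i) ℂ) :
    piMat X * piMat Y = piMat fun i => X i * Y i := by
  ext a c
  simp only [piMat_apply, mul_apply, Fintype.prod_sum, Finset.prod_mul_distrib]

theorem piMat_sum {κ : I → Type} [∀ i, Fintype (κ i)] (X : ∀ i, κ i → Matrix (A i) (B i) ℂ) :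
    (piMat fun i => ∑ k, X i k) = ∑ k : ∀ i, κ i, piMat fun i => X i (k i) := by
  ext a b
  simp only [piMat_apply, Matrix.sum_apply, Fintype.prod_sum]

theorem Diagonalizes.piMat [∀ i, Fintype (A i)] [∀ i, DecidableEq (A i)]
    {V M : ∀ i, Matrix (A i) (A i) ℂ} {s : ∀ i, A i → ℝ}
    (h : ∀ i, Diagonalizes (V i) (s i) (M i)) :
    Diagonalizes (piMat V) (fun a => ∏ i, s i (a i)) (piMat M) := by
  constructor
  · rw [piMat_conjTranspose, piMat_mul, ← piMat_one]
    exact congrArg _ (funext fun i => (h i).1)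
  · rw [piMat_conjTranspose]
    simp only [Complex.ofReal_prod]
    rw [← piMat_diagonal fun i a => (s i a : ℂ), piMat_mul, piMat_mul]
    exact congrArg _ (funext fun i => (h i).2)

end PiMat

section Marginal

variable [DecidableEq I] {A : I → Type}

theorem piSplitAt_symm_same (j : I) (x : A j) (d : ∀ i : {i // i ≠ j}, A i) :
    (Equiv.piSplitAt j A).symm (x, d) j = x := by
  simp [Equiv.piSplitAt]

theorem piSplitAt_symm_ne (j : I) (x : A j) (d : ∀ i : {i // i ≠ j}, A i) (i : {i // i ≠ j}) :
    (Equiv.piSplitAt j A).symm (x, d) i = d i := by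
  simp [Equiv.piSplitAt, i.2]

variable [Fintype I] [∀ i, Fintype (A i)]

/-- The reduced matrix on the tensor factor `j`. -/
noncomputable def marginal (j : I) :
    Matrix (∀ i, A i) (∀ i, A i) ℂ →ₗ[ℂ] Matrix (A j) (A j) ℂ where
  toFun Y := ∑ d : ∀ i : {i // i ≠ j}, A i, Y.submatrix
    (fun x => (Equiv.piSplitAt j A).symm (x, d)) (fun x => (Equiv.piSplitAt j A).symm (x, d))
  map_add' X Y := by simp [submatrix_add, Finset.sum_add_distrib]
  map_smul' c X := by simp [submatrix_smul, Finset.smul_sum]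

theorem marginal_apply (j : I) (Y : Matrix (∀ i, A i) (∀ i, A i) ℂ) (x y : A j) :
    marginal j Y x y = ∑ d : ∀ i : {i // i ≠ j}, A i,
      Y ((Equiv.piSplitAt j A).symm (x, d)) ((Equiv.piSplitAt j A).symm (y, d)) := by
  simp [marginal, Matrix.sum_apply]

theorem sum_eq_sum_piSplitAt {W : Type*} [AddCommMonoid W] (j : I) (f : (∀ i, A i) → W) :
    ∑ c, f c = ∑ x : A j, ∑ d : ∀ i : {i // i ≠ j}, A i,
      f ((Equiv.piSplitAt j A).symm (x, d)) := by
  rw [← (Equiv.piSplitAt j A).symm.sum_comp, Fintype.sum_prod_type]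

theorem IsDensity.marginal {ρ : Matrix (∀ i, A i) (∀ i, A i) ℂ} (h : IsDensity ρ) (j : I) :
    IsDensity (marginal j ρ) := by
  refine ⟨posSemidef_sum _ fun d _ => h.1.submatrix _, ?_⟩
  rw [← h.2, trace, trace, sum_eq_sum_piSplitAt j]
  simp only [diag_apply, marginal_apply]

theorem marginal_piMat (j : I) (X : ∀ i, Matrix (A i) (A i) ℂ) :
    marginal j (piMat X) = (∏ i : {i // i ≠ j}, (X i).trace) • X j := by
  ext x y
  rw [marginal_apply]
  simp only [piMat_apply, Fintype.prod_eq_mul_prod_subtype_ne _ j, piSplitAt_symm_same,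
    piSplitAt_symm_ne, trace, diag_apply, Fintype.prod_sum, Matrix.smul_apply, smul_eq_mul]
  rw [← Finset.mul_sum, mul_comm]

end Marginal

namespace KrausFamily

variable [Fintype I] [DecidableEq I] {A B C : I → Type} [∀ i, Fintype (A i)] [∀ i, DecidableEq (A i)]
  [∀ i, Fintype (B i)] [∀ i, DecidableEq (B i)] [∀ i, Fintype (C i)] [∀ i, DecidableEq (C i)]

/-- The tensor product of a finite family of Kraus families. -/
noncomputable def pi (M : ∀ i, KrausFamily (A i) (B i)) :
    KrausFamily (∀ i, A i) (∀ i, B i) where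
  ι := ∀ i, (M i).ι
  K k := piMat fun i => (M i).K (k i)

theorem pi_apply_piMat (M : ∀ i, KrausFamily (A i) (B i)) (X : ∀ i, Matrix (A i) (A i) ℂ) :
    (pi M).apply (piMat X) = piMat fun i => (M i).apply (X i) := by
  simp only [apply, piMat_sum]
  refine Finset.sum_congr rfl fun k _ => ?_
  simp only [pi, piMat_conjTranspose, piMat_mul]

theorem IsChannel.pi {M : ∀ i, KrausFamily (A i) (B i)} (h : ∀ i, (M i).IsChannel) :
    (pi M).IsChannel := by
  have h1 : (piMat fun i => ∑ k, ((M i).K k)ᴴ * (M i).K k) = 1 := by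
    rw [← piMat_one]
    exact congrArg _ (funext h)
  rw [piMat_sum] at h1
  rw [IsChannel, ← h1]
  refine Finset.sum_congr rfl fun k _ => ?_
  simp only [KrausFamily.pi, piMat_conjTranspose, piMat_mul]

theorem pi_apply_pi_apply {M : ∀ i, KrausFamily (A i) (B i)} {D : ∀ i, KrausFamily (B i) (C i)}
    {L : ∀ i, KrausFamily (A i) (C i)}
    (h : ∀ i X, (D i).apply ((M i).apply X) = (L i).apply X)
    (Y : Matrix (∀ i, A i) (∀ i, A i) ℂ) :
    (pi D).apply ((pi M).apply Y) = (pi L).apply Y := by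
  have : (pi D).applyLin ∘ₗ (pi M).applyLin = (pi L).applyLin := linearMap_ext_piMat fun X => by
    simp only [LinearMap.comp_apply, applyLin_apply, pi_apply_piMat, h]
  exact LinearMap.congr_fun this Y

theorem marginal_pi_apply {M : ∀ i, KrausFamily (A i) (B i)} (hM : ∀ i, (M i).IsChannel) (j : I)
    (Y : Matrix (∀ i, A i) (∀ i, A i) ℂ) :
    marginal j ((pi M).apply Y) = (M j).apply (marginal j Y) := by
  have : marginal j ∘ₗ (pi M).applyLin = (M j).applyLin ∘ₗ marginal j :=
    linearMap_ext_piMat fun X => by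
      simp only [LinearMap.comp_apply, applyLin_apply, pi_apply_piMat, marginal_piMat,
        (hM _).trace_apply]
      rw [← applyLin_apply, ← applyLin_apply, map_smul]
  exact LinearMap.congr_fun this Y

theorem pi_compl (M : ∀ i, KrausFamily (A i) (B i)) (Y : Matrix (∀ i, A i) (∀ i, A i) ℂ) :
    (pi M).compl Y = (pi fun i => (M i).complFamily).apply Y := by
  rw [← complFamily_apply]
  rfl

/-- Conjugation by a single matrix as a Kraus family. -/
def conj {m : Type} [Fintype m] [DecidableEq m] (U : Matrix m m ℂ) : KrausFamily m m where
  ι := Unit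
  K _ := Uᴴ

theorem conj_apply {m : Type} [Fintype m] [DecidableEq m] (U X : Matrix m m ℂ) :
    (conj U).apply X = Uᴴ * X * U := by
  change ∑ _ : Unit, Uᴴ * X * Uᴴᴴ = _
  simp

theorem isChannel_conj {m : Type} [Fintype m] [DecidableEq m] {U : Matrix m m ℂ}
    (h : U * Uᴴ = 1) : (conj U).IsChannel := by
  change ∑ _ : Unit, Uᴴᴴ * Uᴴ = 1
  simpa using h

theorem pi_conj_apply (U : ∀ i, Matrix (A i) (A i) ℂ) (Y : Matrix (∀ i, A i) (∀ i, A i) ℂ) :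
    (pi fun i => conj (U i)).apply Y = (piMat U)ᴴ * Y * piMat U := by
  rw [← conj_apply]
  have : (pi fun i => conj (U i)).applyLin = (conj (piMat U)).applyLin :=
    linearMap_ext_piMat fun X => by
      simp only [applyLin_apply, pi_apply_piMat, conj_apply, piMat_conjTranspose, piMat_mul]
  exact LinearMap.congr_fun this Y

end KrausFamily

section MutualInformation

variable [Fintype I] [DecidableEq I] {A : I → Type} [∀ i, Fintype (A i)] [∀ i, DecidableEq (A i)]
  {ρ : Matrix (∀ i, A i) (∀ i, A i) ℂ} {V : ∀ i, Matrix (A i) (A i) ℂ} {s : ∀ i, A i → ℝ}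

theorem sum_diag_piMat_conj (hV : ∀ i, Diagonalizes (V i) (s i) (marginal i ρ)) (j : I) (x : A j) :
    ∑ d : ∀ i : {i // i ≠ j}, A i, (((piMat V)ᴴ * ρ * piMat V)
      ((Equiv.piSplitAt j A).symm (x, d)) ((Equiv.piSplitAt j A).symm (x, d))).re = s j x := by
  rw [← Complex.re_sum, ← marginal_apply, ← KrausFamily.pi_conj_apply,
    KrausFamily.marginal_pi_apply, KrausFamily.conj_apply, (hV j).compress, diagonal_apply_eq,
    Complex.ofReal_re]
  exact fun i => KrausFamily.isChannel_conj (hV i).mul_conjTranspose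

theorem diag_piMat_conj_eq_zero (hρ : ρ.PosSemidef)
    (hV : ∀ i, Diagonalizes (V i) (s i) (marginal i ρ)) (c : ∀ i, A i)
    (hc : ∏ i, s i (c i) = 0) : (((piMat V)ᴴ * ρ * piMat V) c c).re = 0 := by
  obtain ⟨j, -, hj⟩ := Finset.prod_eq_zero_iff.1 hc
  have h := sum_diag_piMat_conj hV j (c j)
  rw [hj, Finset.sum_eq_zero_iff_of_nonneg fun d _ => (Complex.nonneg_iff.1
    (hρ.conjTranspose_mul_mul_same (piMat V)).diag_nonneg).1] at h
  have h2 := h (Equiv.piSplitAt j A c).2 (Finset.mem_univ _)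
  rwa [show (c j, (Equiv.piSplitAt j A c).2) = Equiv.piSplitAt j A c from rfl,
    Equiv.symm_apply_apply] at h2

/-- The cross term of a state against the product of its marginals. -/
theorem crossLog_piMat (hρ : ρ.PosSemidef)
    (hV : ∀ i, Diagonalizes (V i) (s i) (marginal i ρ)) :
    crossLog (piMat V) (fun c => ∏ i, s i (c i)) ρ = -∑ i, vnEntropy (marginal i ρ) := by
  have h (c : ∀ i, A i) : (((piMat V)ᴴ * ρ * piMat V) c c).re * Real.logb 2 (∏ i, s i (c i))
      = ∑ i, (((piMat V)ᴴ * ρ * piMat V) c c).re * Real.logb 2 (s i (c i)) := by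
    by_cases hc : ∏ i, s i (c i) = 0
    · simp [diag_piMat_conj_eq_zero hρ hV c hc]
    · rw [← Finset.mul_sum, Real.logb_prod _ _ fun i _ => Finset.prod_ne_zero_iff.1 hc i
        (Finset.mem_univ i)]
  rw [crossLog]
  simp only [h]
  rw [Finset.sum_comm, ← Finset.sum_neg_distrib]
  refine Finset.sum_congr rfl fun j _ => ?_
  rw [(hV j).vnEntropy_eq, neg_neg, sum_eq_sum_piSplitAt j]
  refine Finset.sum_congr rfl fun x _ => ?_
  simp only [piSplitAt_symm_same]
  rw [← Finset.sum_mul, sum_diag_piMat_conj hV j x]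

end MutualInformation

namespace KrausFamily

variable [Fintype I] [DecidableEq I] {A B : I → Type} [∀ i, Fintype (A i)] [∀ i, DecidableEq (A i)]
  [∀ i, Fintype (B i)] [∀ i, DecidableEq (B i)]

/-- Mutual information does not increase under local channels. -/
theorem mutualInfo_pi_apply_le {D : ∀ i, KrausFamily (A i) (B i)} (hD : ∀ i, (D i).IsChannel)
    {ρ : Matrix (∀ i, A i) (∀ i, A i) ℂ} (hρ : IsDensity ρ) :
    ∑ i, vnEntropy (marginal i ((pi D).apply ρ)) - vnEntropy ((pi D).apply ρ)
      ≤ ∑ i, vnEntropy (marginal i ρ) - vnEntropy ρ := by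
  have hρ' := (IsChannel.pi hD).isDensity_apply hρ
  choose V s hV hs using fun i => (hρ.marginal i).1.exists_diagonalizes
  choose V' s' hV' hs' using fun i => (hρ'.marginal i).1.exists_diagonalizes
  have hσ' : (pi D).apply (piMat fun i => marginal i ρ)
      = piMat fun i => marginal i ((pi D).apply ρ) := by
    simp only [pi_apply_piMat, marginal_pi_apply hD]
  have hVσ := Diagonalizes.piMat hV
  have hnn (c : ∀ i, A i) : 0 ≤ ∏ i, s i (c i) := Finset.prod_nonneg fun i _ => hs i _
  have hσ : (piMat fun i => marginal i ρ).PosSemidef := by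
    rw [hVσ.2]
    refine PosSemidef.mul_mul_conjTranspose_same (PosSemidef.diagonal fun c => ?_) _
    exact Complex.zero_le_real.2 (hnn c)
  have h := (IsChannel.pi hD).relEntropy_apply_le hρ.1 hσ hVσ
    (hσ' ▸ Diagonalizes.piMat hV') hnn (fun c => Finset.prod_nonneg fun i _ => hs' i _)
    (diag_piMat_conj_eq_zero hρ.1 hV) (diag_piMat_conj_eq_zero hρ'.1 hV')
  rw [crossLog_piMat hρ.1 hV, crossLog_piMat hρ'.1 hV'] at h
  linarith

/-- Subadditivity of coherent information on tensor products of degradable channels. -/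
theorem cohInfo_pi_le {M : ∀ i, KrausFamily (A i) (B i)} (hM : ∀ i, (M i).IsChannel)
    (hdeg : ∀ i, (M i).IsDegradable) {φ : Matrix (∀ i, A i) (∀ i, A i) ℂ} (hφ : IsDensity φ) :
    cohInfo (pi M) φ ≤ ∑ i, cohInfo (M i) (marginal i φ) := by
  choose D hD hDM using hdeg
  have h := mutualInfo_pi_apply_le hD ((IsChannel.pi hM).isDensity_apply hφ)
  rw [pi_apply_pi_apply (L := fun i => (M i).complFamily) fun i X => by
    rw [hDM, complFamily_apply]] at h
  simp only [marginal_pi_apply hM, marginal_pi_apply fun i => (hM i).complFamily,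
    complFamily_apply] at h
  have e : cohInfo (pi M) φ = vnEntropy ((pi M).apply φ)
      - vnEntropy ((pi fun i => (M i).complFamily).apply φ) := by
    rw [cohInfo, pi_compl]
    rfl
  rw [e]
  simp only [cohInfo, Finset.sum_sub_distrib]
  linarith

end KrausFamily

end Tensor

section Convexity

open Matrix

theorem resolventForm_sum {n κ : Type} [Fintype n] [Fintype κ] (p : κ → ℝ)
    (ρ σ : κ → Matrix n n ℂ) (t : ℝ) (X : Matrix n n ℂ) :
    resolventForm t X (∑ k, (p k : ℂ) • ρ k) (∑ k, (p k : ℂ) • σ k)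
      = ∑ k, p k * resolventForm t X (ρ k) (σ k) := by
  simp only [resolventForm, Matrix.sum_mul, trace_sum, Complex.re_sum, Matrix.smul_mul, trace_smul,
    smul_eq_mul, Complex.re_ofReal_mul, mul_sub, Finset.sum_sub_distrib, Finset.mul_sum]
  simp only [mul_left_comm]

theorem Diagonalizes.kronecker_one {m n : Type} [Fintype m] [DecidableEq m] [Fintype n]
    [DecidableEq n] {V M : Matrix m m ℂ} {s : m → ℝ} (h : Diagonalizes V s M) :
    Diagonalizes (V ⊗ₖ (1 : Matrix n n ℂ)) (fun x => s x.1) (M ⊗ₖ (1 : Matrix n n ℂ)) := by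
  constructor
  · rw [conjTranspose_kronecker, ← mul_kronecker_mul, h.1, conjTranspose_one, Matrix.mul_one,
      one_kronecker_one]
  · have e : diagonal (fun x : m × n => ((s x.1 : ℝ) : ℂ))
        = diagonal (fun i => (s i : ℂ)) ⊗ₖ (1 : Matrix n n ℂ) := by
      rw [← diagonal_one, diagonal_kronecker_diagonal]
      simp
    rw [e, conjTranspose_kronecker, ← mul_kronecker_mul, ← mul_kronecker_mul, ← h.2]
    simp

theorem sum_diag_kronecker_one_conj {m n : Type} [Fintype m] [DecidableEq m] [Fintype n]
    [DecidableEq n] (V : Matrix m m ℂ) (R : Matrix (m × n) (m × n) ℂ) (b : m) :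
    ∑ a, ((V ⊗ₖ (1 : Matrix n n ℂ))ᴴ * R * (V ⊗ₖ (1 : Matrix n n ℂ))) (b, a) (b, a)
      = (Vᴴ * (of fun x y => ∑ a, R (x, a) (y, a)) * V) b b := by
  simp only [conjTranspose_kronecker, conjTranspose_one, mul_apply, Fintype.sum_prod_type,
    kronecker_apply, one_apply, mul_ite, ite_mul, mul_one, mul_zero, zero_mul, of_apply,
    Finset.sum_ite_eq, Finset.mem_univ, if_true, Finset.mul_sum,
    Finset.sum_mul]
  rw [Finset.sum_comm]
  refine Finset.sum_congr rfl fun y _ => ?_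
  simp only [Finset.sum_ite_irrel, Finset.sum_const_zero, Finset.sum_ite_eq', Finset.mem_univ,
    if_true]
  rw [Finset.sum_comm]

namespace KrausFamily

/-- The joint state of output and reference when the input `S * Sᴴ` is purified by `S`. -/
noncomputable def choi (N : KrausFamily A B) (S : Matrix A A ℂ) : Matrix (B × A) (B × A) ℂ :=
  ((of fun k x => (N.K k * S) x.1 x.2)ᴴ * (of fun k x => (N.K k * S) x.1 x.2))ᵀ

theorem choi_apply (N : KrausFamily A B) (S : Matrix A A ℂ) (x y : B × A) :
    N.choi S x y = ∑ k, (N.K k * S) x.1 x.2 * star ((N.K k * S) y.1 y.2) := by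
  simp [choi, mul_apply, mul_comm]

theorem choi_eq_apply (N : KrausFamily A B) (S : Matrix A A ℂ) (x y : B × A) :
    N.choi S x y = N.apply (S * single x.2 y.2 1 * Sᴴ) x.1 y.1 := by
  rw [choi_apply, apply, Matrix.sum_apply]
  refine Finset.sum_congr rfl fun k _ => ?_
  have e : N.K k * (S * single x.2 y.2 1 * Sᴴ) * (N.K k)ᴴ
      = N.K k * S * single x.2 y.2 (1 : ℂ) * (N.K k * S)ᴴ := by
    simp only [conjTranspose_mul, Matrix.mul_assoc]
  rw [e]
  generalize N.K k * S = P
  rw [mul_apply, Finset.sum_eq_single y.2 _ (by simp)]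
  · simp [conjTranspose_apply]
  · intro c _ hc
    rw [mul_single_apply_of_ne _ _ _ _ _ hc, zero_mul]

theorem choi_posSemidef (N : KrausFamily A B) (S : Matrix A A ℂ) : (N.choi S).PosSemidef :=
  (posSemidef_conjTranspose_mul_self _).transpose

theorem vnEntropy_choi (N : KrausFamily A B) (S : Matrix A A ℂ) :
    vnEntropy (N.choi S) = vnEntropy (N.compl (S * Sᴴ)) := by
  rw [choi, vnEntropy_transpose (isHermitian_conjTranspose_mul_self _),
    ← vnEntropy_mul_conjTranspose_comm]
  congr 1
  ext i j
  have e : N.K i * (S * Sᴴ) * (N.K j)ᴴ = (N.K i * S) * (N.K j * S)ᴴ := by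
    simp only [conjTranspose_mul, Matrix.mul_assoc]
  rw [compl, of_apply, e]
  simp only [mul_apply, trace, diag_apply, Fintype.sum_prod_type, conjTranspose_apply, of_apply]

theorem sum_choi (N : KrausFamily A B) (S : Matrix A A ℂ) :
    (of fun x y => ∑ a, N.choi S (x, a) (y, a)) = N.apply (S * Sᴴ) := by
  ext x y
  simp only [of_apply, choi_apply]
  rw [Finset.sum_comm, apply, Matrix.sum_apply]
  refine Finset.sum_congr rfl fun k _ => ?_
  have e : N.K k * (S * Sᴴ) * (N.K k)ᴴ = (N.K k * S) * (N.K k * S)ᴴ := by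
    simp only [conjTranspose_mul, Matrix.mul_assoc]
  rw [e, mul_apply]
  rfl

section

variable {N : KrausFamily A B} {S : Matrix A A ℂ} {V : Matrix B B ℂ} {s : B → ℝ}

theorem sum_diag_choi (hV : Diagonalizes V s (N.apply (S * Sᴴ))) (b : B) :
    ∑ a, (((V ⊗ₖ (1 : Matrix A A ℂ))ᴴ * N.choi S * (V ⊗ₖ (1 : Matrix A A ℂ)))
      (b, a) (b, a)).re = s b := by
  rw [← Complex.re_sum, sum_diag_kronecker_one_conj, sum_choi, hV.compress, diagonal_apply_eq,
    Complex.ofReal_re]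

theorem diag_choi_eq_zero (hV : Diagonalizes V s (N.apply (S * Sᴴ))) (x : B × A)
    (hx : s x.1 = 0) :
    (((V ⊗ₖ (1 : Matrix A A ℂ))ᴴ * N.choi S * (V ⊗ₖ (1 : Matrix A A ℂ))) x x).re = 0 := by
  have h := sum_diag_choi hV x.1
  rw [hx, Finset.sum_eq_zero_iff_of_nonneg fun a _ => (Complex.nonneg_iff.1
    ((N.choi_posSemidef S).conjTranspose_mul_mul_same _).diag_nonneg).1] at h
  exact h x.2 (Finset.mem_univ _)

theorem crossLog_choi (hV : Diagonalizes V s (N.apply (S * Sᴴ))) :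
    crossLog (V ⊗ₖ (1 : Matrix A A ℂ)) (fun x => s x.1) (N.choi S)
      = -vnEntropy (N.apply (S * Sᴴ)) := by
  rw [hV.vnEntropy_eq, neg_neg, crossLog, Fintype.sum_prod_type]
  refine Finset.sum_congr rfl fun b _ => ?_
  simp only
  rw [← Finset.sum_mul, sum_diag_choi hV]

end

/-- Coherent information is convex in the channel. -/
theorem cohInfo_le_sum {κ : Type} [Fintype κ] {p : κ → ℝ} (hp : ∀ k, 0 ≤ p k)
    {N : KrausFamily A B} {M : κ → KrausFamily A B}
    (h : ∀ X, N.apply X = ∑ k, (p k : ℂ) • (M k).apply X) {φ : Matrix A A ℂ}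
    (hφ : φ.PosSemidef) : cohInfo N φ ≤ ∑ k, p k * cohInfo (M k) φ := by
  obtain ⟨S, rfl⟩ : ∃ S : Matrix A A ℂ, φ = S * Sᴴ := by
    obtain ⟨U, r, hU, hr⟩ := hφ.exists_diagonalizes
    have e : diagonal (fun i => (r i : ℂ))
        = diagonal (fun i => (√(r i) : ℂ)) * (diagonal fun i => (√(r i) : ℂ))ᴴ := by
      rw [diagonal_conjTranspose, diagonal_mul_diagonal]
      congr 1
      ext i
      simp [← Complex.ofReal_mul, Real.mul_self_sqrt (hr i)]
    refine ⟨U * diagonal fun i => (√(r i) : ℂ), ?_⟩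
    rw [hU.2, e, conjTranspose_mul]
    simp only [Matrix.mul_assoc]
  choose V s hV hs using fun k => ((M k).apply_posSemidef hφ).exists_diagonalizes
  obtain ⟨V', s', hV', hs'⟩ := (N.apply_posSemidef hφ).exists_diagonalizes
  have hchoi : N.choi S = ∑ k, (p k : ℂ) • (M k).choi S := by
    ext x y
    simp only [choi_eq_apply, h, Matrix.sum_apply, Matrix.smul_apply]
  have hσ : N.apply (S * Sᴴ) ⊗ₖ (1 : Matrix A A ℂ)
      = ∑ k, (p k : ℂ) • ((M k).apply (S * Sᴴ) ⊗ₖ (1 : Matrix A A ℂ)) := by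
    ext x y
    rw [h]
    simp only [kroneckerMap_apply, Matrix.sum_apply, Matrix.smul_apply, Finset.sum_mul,
      smul_eq_mul, mul_assoc]
  have key := relEntropy_le_of_resolventForm_le hp
    (fun k => (M k).choi_posSemidef S) (N.choi_posSemidef S)
    (fun k => (hV k).kronecker_one (n := A)) (hV'.kronecker_one (n := A))
    (fun k x => hs k x.1) (fun x => hs' x.1) (fun k => diag_choi_eq_zero (hV k))
    (diag_choi_eq_zero hV')
    (by simp only [hchoi, trace_sum, Complex.re_sum, trace_smul, smul_eq_mul,
          Complex.re_ofReal_mul])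
    fun X => ⟨fun _ => X, fun t _ => by rw [hchoi, hσ, resolventForm_sum]⟩
  simp only [crossLog_choi hV', crossLog_choi (hV _), vnEntropy_choi] at key
  simp only [cohInfo]
  convert key using 1
  · ring
  · exact Finset.sum_congr rfl fun k _ => by ring

/-- Tensor powers of a convex combination of Kraus families. -/
theorem pi_apply_eq_sum {I κ : Type} [Fintype I] [DecidableEq I] [Fintype κ] {p : κ → ℝ}
    {N : KrausFamily A B} {M : κ → KrausFamily A B}
    (h : ∀ X, N.apply X = ∑ k, (p k : ℂ) • (M k).apply X) (Y : Matrix (I → A) (I → A) ℂ) :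
    (pi fun _ => N).apply Y
      = ∑ f : I → κ, ((∏ i, p (f i) : ℝ) : ℂ) • (pi fun i => M (f i)).apply Y := by
  have e : (pi fun _ : I => N).applyLin
      = ∑ f : I → κ, ((∏ i, p (f i) : ℝ) : ℂ) • (pi fun i => M (f i)).applyLin :=
    linearMap_ext_piMat fun X => by
      simp only [applyLin_apply, pi_apply_piMat, LinearMap.sum_apply, LinearMap.smul_apply, h,
        piMat_sum, Complex.ofReal_prod]
      exact Finset.sum_congr rfl fun f _ => piMat_smul _ _
  simpa only [applyLin_apply, LinearMap.sum_apply, LinearMap.smul_apply] using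
    LinearMap.congr_fun e Y

theorem Q1_of_isEmpty (N : KrausFamily A B) (h : IsEmpty A) : Q1 N = 0 := by
  have e : {x | ∃ φ : Matrix A A ℂ, IsDensity φ ∧ x = cohInfo N φ} = ∅ := by
    refine Set.eq_empty_iff_forall_notMem.2 ?_
    rintro x ⟨φ, hφ, -⟩
    simpa [trace] using hφ.2
  rw [Q1, e, Real.sSup_empty]

end KrausFamily

/-- The expectation of a function of one coordinate under a product weight. -/
theorem sum_prod_mul_apply {I κ : Type} [Fintype I] [DecidableEq I] [Fintype κ] {p : κ → ℝ}
    (hp : ∑ k, p k = 1) (g : κ → ℝ) (j : I) :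
    ∑ f : I → κ, (∏ i, p (f i)) * g (f j) = ∑ k, p k * g k := by
  have e (f : I → κ) : (∏ i, p (f i)) * g (f j)
      = ∏ i, p (f i) * if i = j then g (f i) else 1 := by
    rw [Finset.prod_mul_distrib]
    simp
  simp only [e]
  rw [← Fintype.prod_sum fun i k => p k * if i = j then g k else 1, Fintype.prod_eq_single j]
  · simp
  · intro i hi
    simp [hi, hp]

theorem KrausFamily.Q1_pow_le {κ : Type} [Fintype κ] {p : κ → ℝ} {N : KrausFamily A B}
    {M : κ → KrausFamily A B} (hM : ∀ k, (M k).IsChannel) (hdeg : ∀ k, (M k).IsDegradable)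
    (hp : ∀ k, 0 ≤ p k) (hp1 : ∑ k, p k = 1)
    (h : ∀ X, N.apply X = ∑ k, (p k : ℂ) • (M k).apply X) {n : ℕ} (hn : 0 < n) :
    Q1 (N.pow n) ≤ n * ∑ k, p k * Q1 (M k) := by
  rcases isEmpty_or_nonempty A with hA | ⟨⟨a⟩⟩
  · have : Nonempty (Fin n) := ⟨⟨0, hn⟩⟩
    simp only [Q1_of_isEmpty _ hA, Q1_of_isEmpty _ (inferInstance : IsEmpty (Fin n → A))]
    simp
  · refine csSup_le ⟨_, single (fun _ => a) (fun _ => a) 1,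
      ⟨?_, by simp [trace_single_eq_same]⟩, rfl⟩ ?_
    · rw [← diagonal_single]
      exact PosSemidef.diagonal (Pi.single_nonneg.2 zero_le_one)
    rintro x ⟨φ, hφ, rfl⟩
    calc cohInfo (pi fun _ : Fin n => N) φ
        ≤ ∑ f : Fin n → κ, (∏ i, p (f i)) * cohInfo (pi fun i => M (f i)) φ :=
          cohInfo_le_sum (fun f => Finset.prod_nonneg fun i _ => hp _) (pi_apply_eq_sum h) hφ.1
      _ ≤ ∑ f : Fin n → κ, (∏ i, p (f i)) * ∑ i, Q1 (M (f i)) := by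
          refine Finset.sum_le_sum fun f _ => mul_le_mul_of_nonneg_left ?_
            (Finset.prod_nonneg fun i _ => hp _)
          exact (cohInfo_pi_le (fun i => hM (f i)) (fun i => hdeg (f i)) hφ).trans
            (Finset.sum_le_sum fun i _ => cohInfo_le_Q1 (hM _) (hφ.marginal i))
      _ = n * ∑ k, p k * Q1 (M k) := by
          simp only [Finset.mul_sum]
          rw [Finset.sum_comm]
          simp only [sum_prod_mul_apply hp1 fun k => Q1 (M k)]
          simp [Finset.mul_sum]

end Convexity

/-- If a quantum channel `N` decomposes as a convex combination
`N = Σᵢ pᵢ Nᵢ` of degradable channels `Nᵢ`, then `Q(N) ≤ Σᵢ pᵢ Q^{(1)}(Nᵢ)`. -/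
theorem quantum_capacity_le_of_convex_degradable_decomposition
    {A B : Type} [Fintype A] [DecidableEq A] [Fintype B] [DecidableEq B]
    {m : ℕ} (N : KrausFamily A B) (Ni : Fin m → KrausFamily A B) (p : Fin m → ℝ)
    (hN : N.IsChannel) (hchan : ∀ i, (Ni i).IsChannel) (hdeg : ∀ i, (Ni i).IsDegradable)
    (hp : ∀ i, 0 ≤ p i) (hp1 : ∑ i, p i = 1)
    (hdecomp : ∀ ρ : Matrix A A ℂ, N.apply ρ = ∑ i, ((p i : ℝ) : ℂ) • (Ni i).apply ρ) :
    Qcap N ≤ ∑ i, p i * Q1 (Ni i) := by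
  refine csSup_le ⟨_, 1, Nat.one_pos, rfl⟩ ?_
  rintro x ⟨n, hn, rfl⟩
  rw [one_div, inv_mul_le_iff₀ (Nat.cast_pos.2 hn)]
  exact KrausFamily.Q1_pow_le hchan hdeg hp hp1 hdecomp hn
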